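/- Let n and m be positive integers, and let G and H be connected simple graphs on n vertices and m edges such that H ⪯_W G, i.e., W_G(x,y) - W_H(x,y) = (1 - xy)·P(x,y) for some nonnegative polynomial P(x,y). Then for each i ∈ {0,1,…,m} and each k ∈ {1,…,n}, N_i^{(k)}(H) ≤ N_i^{(k)}(G). -/

import Mathlib

open MvPolynomial

/-- Number of connected components of the spanning subgraph of a graph on `Fin n`
whose edge set is `s`. -/
noncomputable def ncomp (n : ℕ) (s : Set (Sym2 (Fin n))) : ℕ :=
  Nat.card (SimpleGraph.fromEdgeSet s).ConnectedComponent

/-- `G` is a member of `C_{n,m}`: a connected simple graph on `n` vertices and `m` edges. -/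
def IsCnm (n m : ℕ) (G : SimpleGraph (Fin n)) : Prop :=
  G.Connected ∧ G.edgeSet.ncard = m

/-- `N_i^{(k)}(G)`: the number of spanning subgraphs of `G` (identified with subsets of
`E(G)`) having exactly `i` edges and at most `k` connected components. -/
noncomputable def Ncnt (n : ℕ) (G : SimpleGraph (Fin n)) (i k : ℕ) : ℕ :=
  Set.ncard {s : Set (Sym2 (Fin n)) | s ⊆ G.edgeSet ∧ s.ncard = i ∧ ncomp n s ≤ k}

/-- `N_{i,j}(G)`: the number of spanning subgraphs of `G` having exactly `i` edges and
exactly `j` connected components. -/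
noncomputable def Nexact (n : ℕ) (G : SimpleGraph (Fin n)) (i j : ℕ) : ℕ :=
  Set.ncard {s : Set (Sym2 (Fin n)) | s ⊆ G.edgeSet ∧ s.ncard = i ∧ ncomp n s = j}

/-- The `k`-reliability of `G` at `p`: `R_G^{(k)}(p) = Σ_{i=0}^m N_i^{(k)}(G) p^i (1-p)^{m-i}`. -/
noncomputable def rel (n m : ℕ) (G : SimpleGraph (Fin n)) (k : ℕ) (p : ℝ) : ℝ :=
  ∑ i ∈ Finset.range (m + 1), (Ncnt n G i k : ℝ) * p ^ i * (1 - p) ^ (m - i)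

/-- The Tutte polynomial of `G`, `T_G(x,y) = Σ_{H ∈ S(G)} (x-1)^{r(G)-r(H)} (y-1)^{c(H)}`,
where the rank of the spanning subgraph with edge set `s` is `n - ncomp n s`, so that
`r(G) - r(H) = ncomp n s - ncomp n G.edgeSet`, and the corank is `s.ncard + ncomp n s - n`. -/
noncomputable def tutte (n : ℕ) (G : SimpleGraph (Fin n)) : MvPolynomial (Fin 2) ℝ :=
  ∑ᶠ s ∈ {t : Set (Sym2 (Fin n)) | t ⊆ G.edgeSet},
    (X 0 - 1) ^ (ncomp n s - ncomp n G.edgeSet) * (X 1 - 1) ^ (s.ncard + ncomp n s - n)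

/-- The Whitney polynomial of `G`, `W_G(x,y) = Σ_{H ∈ S(G)} x^{r(G)-r(H)} y^{c(H)}`. -/
noncomputable def whitney (n : ℕ) (G : SimpleGraph (Fin n)) : MvPolynomial (Fin 2) ℝ :=
  ∑ᶠ s ∈ {t : Set (Sym2 (Fin n)) | t ⊆ G.edgeSet},
    X 0 ^ (ncomp n s - ncomp n G.edgeSet) * X 1 ^ (s.ncard + ncomp n s - n)

/-- A bivariate polynomial is nonnegative if all its coefficients are nonnegative. -/
def NonnegPoly (P : MvPolynomial (Fin 2) ℝ) : Prop :=
  ∀ d : Fin 2 →₀ ℕ, 0 ≤ P.coeff d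

/-- `G` is Tutte-maximum in `C_{n,m}`. -/
def TutteMaximum (n m : ℕ) (G : SimpleGraph (Fin n)) : Prop :=
  ∀ H : SimpleGraph (Fin n), IsCnm n m H →
    ∃ P : MvPolynomial (Fin 2) ℝ, NonnegPoly P ∧
      tutte n G - tutte n H = (X 0 + X 1 - X 0 * X 1) * P

/-- `G` is Whitney-maximum in `C_{n,m}`. -/
def WhitneyMaximum (n m : ℕ) (G : SimpleGraph (Fin n)) : Prop :=
  ∀ H : SimpleGraph (Fin n), IsCnm n m H →
    ∃ Q : MvPolynomial (Fin 2) ℝ, NonnegPoly Q ∧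
      whitney n G - whitney n H = (1 - X 0 * X 1) * Q

/-- `G` is strong in `C_{n,m}`. -/
def Strong (n m : ℕ) (G : SimpleGraph (Fin n)) : Prop :=
  ∀ H : SimpleGraph (Fin n), IsCnm n m H →
    ∀ i ≤ m, ∀ k, 1 ≤ k → k ≤ n → Ncnt n H i k ≤ Ncnt n G i k

/-- `G` is a 0-element in `C_{n,m}`. -/
def ZeroElement (n m : ℕ) (G : SimpleGraph (Fin n)) : Prop :=
  ∀ H : SimpleGraph (Fin n), IsCnm n m H → ∀ i ≤ m, Ncnt n H i 1 ≤ Ncnt n G i 1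

/-- `t_k(G)`: the number of spanning forests of `G` composed of exactly `k` trees. -/
noncomputable def tcount (n : ℕ) (G : SimpleGraph (Fin n)) (k : ℕ) : ℕ :=
  Set.ncard {s : Set (Sym2 (Fin n)) |
    s ⊆ G.edgeSet ∧ (SimpleGraph.fromEdgeSet s).IsAcyclic ∧ ncomp n s = k}

/-- `λ^{(k)}(G)`: the minimum number of edges that must be removed from `G` to obtain a
spanning subgraph with more than `k` connected components. -/
noncomputable def lamk (n : ℕ) (G : SimpleGraph (Fin n)) (k : ℕ) : ℕ :=
  sInf {d : ℕ | ∃ D : Set (Sym2 (Fin n)),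
    D ⊆ G.edgeSet ∧ D.ncard = d ∧ k < ncomp n (G.edgeSet \ D)}

/-- `∂^{a+b} P / ∂x^a ∂y^b` evaluated at `(0,0)`. -/
noncomputable def pdevalXY (P : MvPolynomial (Fin 2) ℝ) (a b : ℕ) : ℝ :=
  MvPolynomial.eval (fun _ => (0 : ℝ))
    ((fun q => MvPolynomial.pderiv (0 : Fin 2) q)^[a]
      ((fun q => MvPolynomial.pderiv (1 : Fin 2) q)^[b] P))

/-- Every spanning subgraph has at least as many edges as a spanning forest with the same
components. -/
theorem le_ncard_add_ncomp {n : ℕ} (hn : 0 < n) (s : Set (Sym2 (Fin n))) :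
    n ≤ s.ncard + ncomp n s := by
  set F := SimpleGraph.fromEdgeSet s with hF
  let c₀ : F.ConnectedComponent := F.connectedComponentMk ⟨0, hn⟩
  let f : F.ConnectedComponent → Sym2 (Fin n) := fun c => s(c₀.out, c.out)
  let K := SimpleGraph.fromEdgeSet (s ∪ f '' {c₀}ᶜ)
  have hFK : F ≤ K := SimpleGraph.fromEdgeSet_mono Set.subset_union_left
  have hout (v : Fin n) : K.Reachable c₀.out v := by
    have h1 : K.Reachable (F.connectedComponentMk v).out v :=
      (SimpleGraph.ConnectedComponent.exact (Quot.out_eq _)).mono hFK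
    refine SimpleGraph.Reachable.trans ?_ h1
    by_cases hc : c₀.out = (F.connectedComponentMk v).out
    · rw [← hc]
    · refine SimpleGraph.Adj.reachable ?_
      refine (SimpleGraph.fromEdgeSet_adj _).2 ⟨Or.inr ⟨_, ?_, rfl⟩, hc⟩
      intro h
      exact hc (by rw [Set.mem_singleton_iff.1 h])
  have hK : K.Connected := by
    have : Nonempty (Fin n) := ⟨⟨0, hn⟩⟩
    exact ⟨fun u v => (hout u).symm.trans (hout v)⟩
  have h1 := hK.card_vert_le_card_edgeSet_add_one
  have h2 : K.edgeSet.ncard ≤ s.ncard + ({c₀}ᶜ : Set F.ConnectedComponent).ncard := by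
    refine (Set.ncard_le_ncard (t := s ∪ f '' {c₀}ᶜ) ?_ (Set.toFinite _)).trans
      ((Set.ncard_union_le _ _).trans (Nat.add_le_add_left Set.ncard_image_le _))
    rw [SimpleGraph.edgeSet_fromEdgeSet]
    exact Set.sdiff_subset
  have h3 := Set.ncard_add_ncard_compl ({c₀} : Set F.ConnectedComponent)
  rw [Set.ncard_singleton] at h3
  have h4 : ncomp n s = Nat.card F.ConnectedComponent := rfl
  rw [Nat.card_fin, Nat.card_coe_set_eq] at h1
  omega

theorem ncomp_pos {n : ℕ} (hn : 0 < n) (s : Set (Sym2 (Fin n))) : 0 < ncomp n s := by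
  have : Nonempty (SimpleGraph.fromEdgeSet s).ConnectedComponent :=
    ⟨SimpleGraph.connectedComponentMk _ ⟨0, hn⟩⟩
  exact Nat.card_pos

theorem ncomp_edgeSet_of_connected {n : ℕ} {G : SimpleGraph (Fin n)} (hG : G.Connected) :
    ncomp n G.edgeSet = 1 := by
  rw [ncomp, SimpleGraph.fromEdgeSet_edgeSet, Nat.card_eq_one_iff_unique]
  have := hG.nonempty
  exact ⟨hG.preconnected.subsingleton_connectedComponent,
    ⟨G.connectedComponentMk (Classical.arbitrary _)⟩⟩

/-- The exponent vector of `x ^ a * y ^ b`. -/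
noncomputable def bidegree (a b : ℕ) : Fin 2 →₀ ℕ :=
  Finsupp.single 0 a + Finsupp.single 1 b

theorem bidegree_inj {a b c d : ℕ} : bidegree a b = bidegree c d ↔ a = c ∧ b = d := by
  constructor
  · intro h
    exact ⟨by simpa [bidegree] using DFunLike.congr_fun h 0,
      by simpa [bidegree] using DFunLike.congr_fun h 1⟩
  · rintro ⟨rfl, rfl⟩
    rfl

theorem X_pow_mul_X_pow_eq_monomial (a b : ℕ) :
    (X 0 ^ a * X 1 ^ b : MvPolynomial (Fin 2) ℝ) = monomial (bidegree a b) 1 := by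
  rw [X_pow_eq_monomial, X_pow_eq_monomial, monomial_mul, one_mul, bidegree]

/-- The sum of the coefficients of `x ^ a * y ^ b` with `a < k` and `a + i + 1 = b + n`.
Applied to a Whitney polynomial, it counts the spanning subgraphs with `i` edges and at most
`k` components. -/
noncomputable def diagSum (n i k : ℕ) (Q : MvPolynomial (Fin 2) ℝ) : ℝ :=
  ∑ a ∈ Finset.range k, if n ≤ a + i + 1 then Q.coeff (bidegree a (a + i + 1 - n)) else 0

theorem diagSum_sub (n i k : ℕ) (Q R : MvPolynomial (Fin 2) ℝ) :
    diagSum n i k (Q - R) = diagSum n i k Q - diagSum n i k R := by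
  simp only [diagSum, ← Finset.sum_sub_distrib, coeff_sub]
  refine Finset.sum_congr rfl fun a _ => ?_
  split_ifs <;> simp

theorem diagSum_sum {ι : Type*} (n i k : ℕ) (t : Finset ι) (Q : ι → MvPolynomial (Fin 2) ℝ) :
    diagSum n i k (∑ s ∈ t, Q s) = ∑ s ∈ t, diagSum n i k (Q s) := by
  simp only [diagSum]
  rw [Finset.sum_comm]
  refine Finset.sum_congr rfl fun a _ => ?_
  split_ifs <;> simp [coeff_sum]

theorem diagSum_monomial (n i k c e : ℕ) (hc : 0 < c) (h : n ≤ e + c) :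
    diagSum n i k (monomial (bidegree (c - 1) (e + c - n)) 1) =
      if e = i ∧ c ≤ k then 1 else 0 := by
  have key (a : ℕ) : (if n ≤ a + i + 1 then
      (monomial (bidegree (c - 1) (e + c - n)) (1 : ℝ)).coeff (bidegree a (a + i + 1 - n))
      else 0) = if c - 1 = a then (if e = i then 1 else 0) else 0 := by
    simp only [coeff_monomial, bidegree_inj]
    split_ifs <;> first | rfl | omega
  simp only [diagSum, key, Finset.sum_ite_eq, Finset.mem_range]
  split_ifs <;> first | rfl | omega

theorem coeff_one_sub_X_mul_X_mul (P : MvPolynomial (Fin 2) ℝ) (a b : ℕ) :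
    ((1 - X 0 * X 1) * P).coeff (bidegree a b) = P.coeff (bidegree a b) -
      if 1 ≤ a ∧ 1 ≤ b then P.coeff (bidegree (a - 1) (b - 1)) else 0 := by
  have hX : (X 0 * X 1 : MvPolynomial (Fin 2) ℝ) = monomial (bidegree 1 1) 1 := by
    simpa using X_pow_mul_X_pow_eq_monomial 1 1
  have hle : bidegree 1 1 ≤ bidegree a b ↔ 1 ≤ a ∧ 1 ≤ b := by
    simp [Finsupp.le_def, Fin.forall_fin_two, bidegree]
  have hsub : bidegree a b - bidegree 1 1 = bidegree (a - 1) (b - 1) := by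
    ext j
    fin_cases j <;> simp [bidegree]
  rw [sub_mul, one_mul, coeff_sub, hX, coeff_monomial_mul', one_mul, hsub]
  simp only [hle]

/-- Along a diagonal, the coefficients of `(1 - x * y) * P` telescope. -/
theorem diagSum_one_sub_X_mul_X_mul (n i k : ℕ) (P : MvPolynomial (Fin 2) ℝ) :
    diagSum n i k ((1 - X 0 * X 1) * P) =
      if 0 < k ∧ n ≤ k + i then P.coeff (bidegree (k - 1) (k + i - n)) else 0 := by
  induction k with
  | zero => simp [diagSum]
  | succ k ih =>
    rw [diagSum, Finset.sum_range_succ, ← diagSum, ih, coeff_one_sub_X_mul_X_mul]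
    have e1 : k + 1 + i - n = k + i + 1 - n := by omega
    have e2 : k + i + 1 - n - 1 = k + i - n := by omega
    rw [Nat.add_sub_cancel, e1, e2]
    split_ifs <;> first | omega | ring

theorem diagSum_whitney {n : ℕ} (hn : 0 < n) {G : SimpleGraph (Fin n)} (hG : G.Connected)
    (i k : ℕ) : diagSum n i k (whitney n G) = Ncnt n G i k := by
  classical
  have hfin : {t : Set (Sym2 (Fin n)) | t ⊆ G.edgeSet}.Finite := Set.toFinite _
  rw [whitney, finsum_mem_eq_finite_toFinset_sum _ hfin, diagSum_sum]
  simp only [ncomp_edgeSet_of_connected hG, X_pow_mul_X_pow_eq_monomial,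
    diagSum_monomial _ _ _ _ _ (ncomp_pos hn _) (le_ncard_add_ncomp hn _)]
  rw [Finset.sum_boole, Ncnt, ← Set.ncard_coe_finset]
  congr 2
  ext s
  simp

/-- if `H ⪯_W G` then `N_i^{(k)}(H) ≤ N_i^{(k)}(G)` for all
`i ∈ {0,…,m}` and `k ∈ {1,…,n}`. -/
theorem stmt9 (n m : ℕ) (hn : 0 < n) (hm : 0 < m) (G H : SimpleGraph (Fin n))
    (hG : IsCnm n m G) (hH : IsCnm n m H)
    (hle : ∃ P : MvPolynomial (Fin 2) ℝ, NonnegPoly P ∧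
      whitney n G - whitney n H = (1 - X 0 * X 1) * P) :
    ∀ i ≤ m, ∀ k, 1 ≤ k → k ≤ n → Ncnt n H i k ≤ Ncnt n G i k := by
  intro i _ k _ _
  obtain ⟨P, hP, hle⟩ := hle
  have h := diagSum_sub n i k (whitney n G) (whitney n H)
  rw [hle, diagSum_one_sub_X_mul_X_mul, diagSum_whitney hn hG.1, diagSum_whitney hn hH.1] at h
  have h0 : (0 : ℝ) ≤ Ncnt n G i k - Ncnt n H i k := by
    rw [← h]
    split_ifs
    exacts [hP _, le_rfl]
  exact_mod_cast sub_nonneg.1 h0
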